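/- Let α ∈ (0,1], C₀ > 0, C' > 0, r₀ > 0 and x₀ ∈ ℝ². Let f : ℝ → [0,+∞] (extended-nonnegative-real valued) be nonincreasing, equal to +∞ on (−∞,0], and satisfy liminf_{s→0⁺} f(s) s^{2/α} ≥ C₀. Let g : ℝ² → ℝ be continuous with g(x₀) = 0 and g(y) ≤ C' |y−x₀|^α for all y ∈ B_{r₀}(x₀). Then ∫_{B_{r₀}(x₀)} f(g(y)) dy = +∞. -/

import Mathlib

open MeasureTheory Filter Metric ENNReal

noncomputable section

/-- The plane `ℝ²`. -/
abbrev Plane := EuclideanSpace ℝ (Fin 2)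

/-- In the plane, `|y - x|⁻²` is not integrable near `x`. -/
lemma lintegral_ball_norm_sub_rpow_neg_two (x : Plane) {ρ : ℝ} (hρ : 0 < ρ) :
    (∫⁻ y in ball x ρ, ENNReal.ofReal (‖y - x‖ ^ (-2 : ℝ))) = ⊤ := by
  have hpre : (fun y : Plane => y - x) ⁻¹' ball 0 ρ = ball x ρ := by
    ext y; simp [dist_eq_norm]
  rw [← hpre, (measurePreserving_sub_right volume x).setLIntegral_comp_preimage
    measurableSet_ball (f := fun y => ENNReal.ofReal (‖y‖ ^ (-2 : ℝ))) (by fun_prop)]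
  by_contra h
  have hint : IntegrableOn (fun y : Plane => ‖y‖ ^ (-2 : ℝ)) (ball 0 ρ) :=
    ⟨(by fun_prop : Measurable fun y : Plane => ‖y‖ ^ (-2 : ℝ)).aestronglyMeasurable,
      (hasFiniteIntegral_iff_ofReal (.of_forall fun y => by positivity)).2
        (lt_top_iff_ne_top.2 h)⟩
  rw [integrableOn_fun_norm_addHaar volume (f := fun r : ℝ => r ^ (-2 : ℝ))] at hint
  have hinv : IntegrableOn (fun r : ℝ => r ^ (-1 : ℝ)) (Set.Ioo 0 ρ) := by
    refine hint.congr_fun (fun r hr => ?_) measurableSet_Ioo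
    have hr0 : 0 < r := hr.1
    simp only [finrank_euclideanSpace, Fintype.card_fin, smul_eq_mul]
    rw [← Real.rpow_natCast, ← Real.rpow_add hr0]
    norm_num
  exact absurd ((intervalIntegral.integrableOn_Ioo_rpow_iff hρ).1 hinv) (lt_irrefl _)

/-- If `f : ℝ → [0,+∞]` is nonincreasing, `+∞` on `(-∞,0]` and satisfies
`liminf_{s→0⁺} f(s) s^{2/α} ≥ C₀ > 0`, and `g : ℝ² → ℝ` is continuous with `g(x₀) = 0`
and `g(y) ≤ C' |y-x₀|^α` on `B_{r₀}(x₀)`, then `∫_{B_{r₀}(x₀)} f(g(y)) dy = +∞`. -/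
theorem lintegral_comp_eq_top_of_holder_zero
    (α C' r₀ : ℝ) (C₀ : ℝ≥0∞) (x₀ : Plane)
    (hα : 0 < α) (hα1 : α ≤ 1) (hC' : 0 < C') (hr₀ : 0 < r₀) (hC₀ : 0 < C₀)
    (f : ℝ → ℝ≥0∞) (hmono : Antitone f) (htop : ∀ s ≤ (0 : ℝ), f s = ⊤)
    (hliminf : C₀ ≤ Filter.liminf (fun s : ℝ => f s * ENNReal.ofReal (s ^ (2 / α)))
      (nhdsWithin 0 (Set.Ioi 0)))
    (g : Plane → ℝ) (hg : Continuous g) (hg0 : g x₀ = 0)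
    (hgH : ∀ y ∈ Metric.ball x₀ r₀, g y ≤ C' * ‖y - x₀‖ ^ α) :
    (∫⁻ y in Metric.ball x₀ r₀, f (g y)) = ⊤ := by
  obtain ⟨c, hc0, hc⟩ := exists_between hC₀
  have hs : ∀ᶠ s in nhdsWithin (0 : ℝ) (Set.Ioi 0), c < f s * ENNReal.ofReal (s ^ (2 / α)) :=
    eventually_lt_of_lt_liminf (hc.trans_le hliminf)
  have hlim : Tendsto (fun r : ℝ => C' * r ^ α) (nhdsWithin 0 (Set.Ioi 0))
      (nhdsWithin 0 (Set.Ioi 0)) := by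
    refine tendsto_nhdsWithin_iff.2 ⟨?_, ?_⟩
    · have hcont : Continuous fun r : ℝ => C' * r ^ α :=
        continuous_const.mul (Real.continuous_rpow_const hα.le)
      have h0 := hcont.tendsto 0
      simp only [Real.zero_rpow hα.ne', mul_zero] at h0
      exact h0.mono_left nhdsWithin_le_nhds
    · filter_upwards [self_mem_nhdsWithin] with r hr
      have hr0 : 0 < r := hr
      exact Set.mem_Ioi.2 (by positivity)
  obtain ⟨δ, hδ, hδs⟩ := mem_nhdsGT_iff_exists_Ioo_subset.1 (hlim.eventually hs)
  have hδ0 : 0 < δ := hδ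
  have hρ : 0 < min r₀ δ := lt_min hr₀ hδ0
  set A : ℝ := C' ^ (2 / α) with hA
  have hA0 : 0 < A := by positivity
  have hbound : ∀ y ∈ ball x₀ (min r₀ δ),
      c * ENNReal.ofReal A⁻¹ * ENNReal.ofReal (‖y - x₀‖ ^ (-2 : ℝ)) ≤ f (g y) := by
    intro y hy
    rw [mem_ball, dist_eq_norm, lt_min_iff] at hy
    rcases (norm_nonneg (y - x₀)).eq_or_lt with h0 | h0
    · rw [sub_eq_zero.1 (norm_eq_zero.1 h0.symm), hg0, htop 0 le_rfl]
      exact le_top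
    · have hlt : c < f (C' * ‖y - x₀‖ ^ α) *
          ENNReal.ofReal ((C' * ‖y - x₀‖ ^ α) ^ (2 / α)) := hδs ⟨h0, hy.2⟩
      have hpow : (C' * ‖y - x₀‖ ^ α) ^ (2 / α) = A * ‖y - x₀‖ ^ (2 : ℝ) := by
        rw [Real.mul_rpow hC'.le (by positivity), ← Real.rpow_mul h0.le,
          mul_div_cancel₀ _ hα.ne']
      rw [hpow] at hlt
      calc c * ENNReal.ofReal A⁻¹ * ENNReal.ofReal (‖y - x₀‖ ^ (-2 : ℝ))
          = c / ENNReal.ofReal (A * ‖y - x₀‖ ^ (2 : ℝ)) := by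
            rw [mul_assoc, ← ENNReal.ofReal_mul (by positivity), Real.rpow_neg h0.le,
              ← mul_inv, ENNReal.ofReal_inv_of_pos (by positivity), div_eq_mul_inv]
        _ ≤ f (C' * ‖y - x₀‖ ^ α) := ENNReal.div_le_of_le_mul hlt.le
        _ ≤ f (g y) := hmono (hgH y (by rw [mem_ball, dist_eq_norm]; exact hy.1))
  refine top_unique ?_
  calc (⊤ : ℝ≥0∞)
      = c * ENNReal.ofReal A⁻¹ *
          ∫⁻ y in ball x₀ (min r₀ δ), ENNReal.ofReal (‖y - x₀‖ ^ (-2 : ℝ)) := by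
        rw [lintegral_ball_norm_sub_rpow_neg_two x₀ hρ, ENNReal.mul_top]
        exact mul_ne_zero hc0.ne' (ENNReal.ofReal_pos.2 (inv_pos.2 hA0)).ne'
    _ = ∫⁻ y in ball x₀ (min r₀ δ),
          c * ENNReal.ofReal A⁻¹ * ENNReal.ofReal (‖y - x₀‖ ^ (-2 : ℝ)) :=
        (lintegral_const_mul _ (by fun_prop)).symm
    _ ≤ ∫⁻ y in ball x₀ (min r₀ δ), f (g y) :=
        setLIntegral_mono' measurableSet_ball hbound
    _ ≤ ∫⁻ y in ball x₀ r₀, f (g y) :=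
        lintegral_mono_set (ball_subset_ball (min_le_left _ _))
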